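/- If a C¹ regular closed curve in the plane is embedded except for finitely many transverse self-intersections that come in rotation-cancelling symmetric pairs, and a large simple closed completion of it has rotation number ±1, then the curve is regularly homotopic, with endpoints fixed appropriately, to a curve with no self-intersections. -/

import Mathlib

open Complex Real

open Complex Real

/-- A regular closed curve in the plane (identified with `ℂ`): a `C¹` map, periodic of
period 1 (i.e. defined on `S¹`), with nowhere vanishing derivative. -/
def IsRegularClosedCurve (γ : ℝ → ℂ) : Prop :=
  ContDiff ℝ 1 γ ∧ Function.Periodic γ 1 ∧ ∀ t, deriv γ t ≠ 0

/-- `γ` has rotation number `n`: the winding number of `γ'` about the origin is `n`,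
expressed via a continuous angle function `θ` for the derivative. -/
def HasRotationNumber (γ : ℝ → ℂ) (n : ℤ) : Prop :=
  ∃ θ : ℝ → ℝ, Continuous θ ∧
    (∀ t, deriv γ t = (‖deriv γ t‖ : ℂ) * Complex.exp (θ t * Complex.I)) ∧
    θ 1 - θ 0 = 2 * π * n

/-- A regular homotopy between two regular closed curves: a `C¹` family of regular
closed curves interpolating between them. -/
def IsRegularHomotopy (γ₀ γ₁ : ℝ → ℂ) : Prop :=
  ∃ H : ℝ → ℝ → ℂ,
    ContDiff ℝ 1 (fun p : ℝ × ℝ => H p.1 p.2) ∧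
    (∀ s ∈ Set.Icc (0 : ℝ) 1, IsRegularClosedCurve (H s)) ∧
    H 0 = γ₀ ∧ H 1 = γ₁

/-- The primitive in the second variable of a family that is continuous together with its
derivative in the parameter is jointly `C¹`. -/
theorem contDiff_one_parametric_primitive {f f' : ℝ → ℝ → ℂ}
    (hf : Continuous (Function.uncurry f)) (hf' : Continuous (Function.uncurry f'))
    (hd : ∀ s u, HasDerivAt (fun x => f x u) (f' s u) s) :
    ContDiff ℝ 1 (fun p : ℝ × ℝ => ∫ u in (0 : ℝ)..p.2, f p.1 u) := by
  have hfs : ∀ s, Continuous (f s) := fun s => hf.comp (by fun_prop : Continuous fun u => (s, u))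
  have hfs' : ∀ s, Continuous (f' s) := fun s => hf'.comp (by fun_prop : Continuous fun u => (s, u))
  have key_s : ∀ s t : ℝ, HasDerivAt (fun x => ∫ u in (0 : ℝ)..t, f x u)
      (∫ u in (0 : ℝ)..t, f' s u) s := by
    intro s t
    obtain ⟨C, hC⟩ := ((isCompact_Icc (a := s - 1) (b := s + 1)).prod
      (isCompact_uIcc (a := (0 : ℝ)) (b := t))).exists_bound_of_continuousOn hf'.continuousOn
    refine (intervalIntegral.hasDerivAt_integral_of_dominated_loc_of_deriv_le
      (F := f) (F' := f') (bound := fun _ => C) (s := Set.Icc (s - 1) (s + 1))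
      (Icc_mem_nhds (by linarith) (by linarith)) ?_ ?_ ?_ ?_ ?_ ?_).2
    · exact Filter.Eventually.of_forall fun x => (hfs x).aestronglyMeasurable
    · exact (hfs s).intervalIntegrable _ _
    · exact (hfs' s).aestronglyMeasurable
    · exact Filter.Eventually.of_forall fun u hu x hx =>
        hC (x, u) ⟨hx, Set.uIoc_subset_uIcc hu⟩
    · exact intervalIntegrable_const
    · exact Filter.Eventually.of_forall fun u _ x _ => hd x u
  have key_t : ∀ s t : ℝ, HasDerivAt (fun x => ∫ u in (0 : ℝ)..x, f s u) (f s t) t := fun s t =>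
    (hfs s).integral_hasStrictDerivAt 0 t |>.hasDerivAt
  have cont_s : Continuous (fun p : ℝ × ℝ => ∫ u in (0 : ℝ)..p.2, f' p.1 u) :=
    intervalIntegral.continuous_parametric_primitive_of_continuous hf'
  let L : ℂ →L[ℝ] (ℝ →L[ℝ] ℂ) := (ContinuousLinearMap.smulRightL ℝ ℝ ℂ) 1
  let f₁ : ℝ → ℝ → ℝ →L[ℝ] ℂ := fun s t => L (∫ u in (0 : ℝ)..t, f' s u)
  let f₂ : ℝ → ℝ → ℝ →L[ℝ] ℂ := fun s t => L (f s t)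
  have c₁ : Continuous (Function.uncurry f₁) := L.continuous.comp cont_s
  have c₂ : Continuous (Function.uncurry f₂) := L.continuous.comp hf
  have hF : ∀ p : ℝ × ℝ, HasFDerivAt (fun p : ℝ × ℝ => ∫ u in (0 : ℝ)..p.2, f p.1 u)
      ((Function.uncurry f₁ p).coprod (Function.uncurry f₂ p)) p := by
    intro p
    refine (hasStrictFDerivAt_uncurry_coprod (𝕜 := ℝ) (f := fun s t => ∫ u in (0 : ℝ)..t, f s u)
      (f₁ := f₁) (f₂ := f₂) ?_ ?_ c₁.continuousAt c₂.continuousAt).hasFDerivAt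
    · exact Filter.Eventually.of_forall fun v => (key_s v.1 v.2).hasFDerivAt
    · exact Filter.Eventually.of_forall fun v => (key_t v.1 v.2).hasFDerivAt
  rw [contDiff_one_iff_hasFDerivAt]
  refine ⟨_, ?_, hF⟩
  have : (fun p : ℝ × ℝ => (Function.uncurry f₁ p).coprod (Function.uncurry f₂ p)) =
      fun p => (Function.uncurry f₁ p).comp (ContinuousLinearMap.fst ℝ ℝ ℝ) +
        (Function.uncurry f₂ p).comp (ContinuousLinearMap.snd ℝ ℝ ℝ) := by
    ext p <;> simp
  rw [this]
  exact (c₁.clm_comp continuous_const).add (c₂.clm_comp continuous_const)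

/-- A positively weighted average over the unit interval of a path on the unit circle whose angle
changes by a full turn never meets the path. -/
theorem exp_mul_integral_ne {ρ θ : ℝ → ℝ} (hρ : Continuous ρ) (hθ : Continuous θ)
    (hpos : ∀ t, 0 < ρ t) (hturn : |θ 1 - θ 0| = 2 * π) (t : ℝ) :
    exp (θ t * I) * ((∫ u in (0 : ℝ)..1, ρ u : ℝ) : ℂ) ≠
      ∫ u in (0 : ℝ)..1, (ρ u : ℂ) * exp (θ u * I) := by
  intro h
  have hcos : ∫ u in (0 : ℝ)..1, ρ u = ∫ u in (0 : ℝ)..1, ρ u * Real.cos (θ u - θ t) := by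
    have h2 : ((∫ u in (0 : ℝ)..1, ρ u : ℝ) : ℂ) =
        ∫ u in (0 : ℝ)..1, (ρ u : ℂ) * exp ((θ u - θ t : ℝ) * I) := by
      have h3 : ∀ u, (ρ u : ℂ) * exp ((θ u - θ t : ℝ) * I) =
          exp (-(θ t * I)) * ((ρ u : ℂ) * exp (θ u * I)) := by
        intro u
        rw [mul_left_comm, ← Complex.exp_add]
        congr 2
        push_cast
        ring
      simp_rw [h3]
      rw [intervalIntegral.integral_const_mul, ← h, ← mul_assoc, ← Complex.exp_add]
      simp
    have h4 := congrArg Complex.reCLM h2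
    rw [← ContinuousLinearMap.intervalIntegral_comp_comm] at h4
    · simpa [-Complex.ofReal_sub, Complex.exp_ofReal_mul_I_re] using h4
    · exact Continuous.intervalIntegrable (by fun_prop) _ _
  have hone : ∀ u ∈ Set.Icc (0 : ℝ) 1, Real.cos (θ u - θ t) = 1 := by
    by_contra! hne
    obtain ⟨u, hu, hne⟩ := hne
    refine (intervalIntegral.integral_lt_integral_of_continuousOn_of_le_of_exists_lt zero_lt_one
      (f := fun u => ρ u * Real.cos (θ u - θ t)) (g := ρ)
      (by fun_prop) (by fun_prop) ?_ ⟨u, hu, ?_⟩).ne hcos.symm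
    · exact fun v _ => mul_le_of_le_one_right (hpos v).le (Real.cos_le_one _)
    · exact mul_lt_of_lt_one_right (hpos u) (lt_of_le_of_ne (Real.cos_le_one _) hne)
  obtain ⟨u, hu, hmid⟩ : ∃ u ∈ Set.Icc (0 : ℝ) 1, θ u = (θ 0 + θ 1) / 2 := by
    have hsub := intermediate_value_uIcc (a := (0 : ℝ)) (b := 1) (f := θ) hθ.continuousOn
    rw [Set.uIcc_of_le (zero_le_one' ℝ)] at hsub
    refine hsub ?_
    rw [Set.mem_uIcc]
    rcases le_total (θ 0) (θ 1) with h' | h'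
    · left; constructor <;> linarith
    · right; constructor <;> linarith
  have h0 := hone 0 (by simp)
  have h1 := hone u hu
  rw [hmid] at h1
  rcases (abs_eq (by positivity)).1 hturn with h' | h'
  · rw [show (θ 0 + θ 1) / 2 - θ t = θ 0 - θ t + π by linarith, Real.cos_add_pi] at h1
    linarith
  · rw [show (θ 0 + θ 1) / 2 - θ t = θ 0 - θ t - π by linarith, Real.cos_sub_pi] at h1
    linarith

/-- The angle of a nowhere vanishing periodic path changes by the same amount over every period. -/
theorem angle_add_one {v : ℝ → ℂ} {θ : ℝ → ℝ} (hv : Function.Periodic v 1) (hv0 : ∀ t, v t ≠ 0)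
    (hθ : Continuous θ) (h : ∀ t, v t = (‖v t‖ : ℂ) * exp (θ t * I)) (t : ℝ) :
    θ (t + 1) = θ t + (θ 1 - θ 0) := by
  have hk : ∀ t, ∃ k : ℤ, θ (t + 1) = θ t + k * (2 * π) := by
    intro t
    have h1 := h (t + 1)
    rw [hv t, h t] at h1
    have hn : ((‖v t‖ : ℝ) : ℂ) ≠ 0 := by simpa using hv0 t
    have h2 : exp (θ (t + 1) * I) = exp (θ t * I) := by
      have h3 : ‖(‖v t‖ : ℂ) * exp (θ t * I)‖ = ‖v t‖ := by rw [← h t]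
      rw [h3] at h1
      exact (mul_left_cancel₀ hn h1).symm
    obtain ⟨k, hk⟩ := Complex.exp_eq_exp_iff_exists_int.1 h2
    refine ⟨k, ?_⟩
    have h4 := congrArg Complex.im hk
    simpa using h4
  choose k hk using hk
  have hc : Continuous k := by
    rw [Int.isClosedEmbedding_coe_real.isEmbedding.continuous_iff]
    have : ((↑) : ℤ → ℝ) ∘ k = fun t => (θ (t + 1) - θ t) / (2 * π) := by
      ext t
      rw [hk t]
      field_simp
      simp
    rw [this]
    fun_prop
  have hconst := PreconnectedSpace.constant (inferInstance : PreconnectedSpace ℝ) hc (x := t) (y := 0)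
  have h0 := hk 0
  rw [zero_add] at h0
  rw [hk t, hconst, h0]
  ring

/-- A `C¹` family of positive periodic speeds and of directions making `n = ±1` turns is realized,
after subtracting a multiple of the speed, by a `C¹` family of regular closed curves. No correction
is needed for the members of the family which already close up. -/
theorem exists_contDiff_family_isRegularClosedCurve {ρ ρ' Θ Θ' : ℝ → ℝ → ℝ} {n : ℤ}
    (hn : n = 1 ∨ n = -1)
    (hρc : Continuous (Function.uncurry ρ)) (hρ'c : Continuous (Function.uncurry ρ'))
    (hΘc : Continuous (Function.uncurry Θ)) (hΘ'c : Continuous (Function.uncurry Θ'))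
    (hρd : ∀ s u, HasDerivAt (fun x => ρ x u) (ρ' s u) s)
    (hΘd : ∀ s u, HasDerivAt (fun x => Θ x u) (Θ' s u) s)
    (hρpos : ∀ s u, 0 < ρ s u) (hρper : ∀ s u, ρ s (u + 1) = ρ s u)
    (hΘper : ∀ s u, Θ s (u + 1) = Θ s u + 2 * π * n) (c : ℂ) :
    ∃ H : ℝ → ℝ → ℂ, ContDiff ℝ 1 (fun p : ℝ × ℝ => H p.1 p.2) ∧
      (∀ s, IsRegularClosedCurve (H s)) ∧
      ∀ s, ∫ u in (0 : ℝ)..1, (ρ s u : ℂ) * exp (Θ s u * I) = 0 →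
        ∀ t, H s t = c + ∫ u in (0 : ℝ)..t, (ρ s u : ℂ) * exp (Θ s u * I) := by
  have hρs : ∀ s, Continuous (ρ s) := fun s => hρc.comp (by fun_prop : Continuous fun u => (s, u))
  have hΘs : ∀ s, Continuous (Θ s) := fun s => hΘc.comp (by fun_prop : Continuous fun u => (s, u))
  have hΦs : ∀ s, Continuous fun u => (ρ s u : ℂ) * exp (Θ s u * I) := fun s => by
    have := hρs s
    have := hΘs s
    fun_prop
  have hΦper : ∀ s, Function.Periodic (fun u => (ρ s u : ℂ) * exp (Θ s u * I)) 1 := fun s u => by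
    simp only [hρper, hΘper]
    congr 1
    rw [Complex.exp_eq_exp_iff_exists_int]
    exact ⟨n, by push_cast; ring⟩
  obtain ⟨A, hAdef⟩ : ∃ A : ℝ → ℝ → ℂ,
      ∀ s t, A s t = ∫ u in (0 : ℝ)..t, (ρ s u : ℂ) * exp (Θ s u * I) := ⟨_, fun _ _ => rfl⟩
  obtain ⟨B, hBdef⟩ : ∃ B : ℝ → ℝ → ℂ,
      ∀ s t, B s t = ∫ u in (0 : ℝ)..t, (ρ s u : ℂ) := ⟨_, fun _ _ => rfl⟩
  have hA : ContDiff ℝ 1 (fun p : ℝ × ℝ => A p.1 p.2) := by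
    simp only [hAdef]
    refine contDiff_one_parametric_primitive (f := fun s u => (ρ s u : ℂ) * exp (Θ s u * I))
      (f' := fun s u =>
      (ρ' s u : ℂ) * exp (Θ s u * I) + (ρ s u : ℂ) * (exp (Θ s u * I) * (Θ' s u * I))) ?_ ?_ ?_
    · change Continuous fun p : ℝ × ℝ =>
        ((Function.uncurry ρ p : ℝ) : ℂ) * exp ((Function.uncurry Θ p : ℝ) * I)
      fun_prop
    · change Continuous fun p : ℝ × ℝ =>
        ((Function.uncurry ρ' p : ℝ) : ℂ) * exp ((Function.uncurry Θ p : ℝ) * I) +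
        ((Function.uncurry ρ p : ℝ) : ℂ) * (exp ((Function.uncurry Θ p : ℝ) * I) *
          ((Function.uncurry Θ' p : ℝ) * I))
      fun_prop
    · intro s u
      exact (hρd s u).ofReal_comp.mul (((hΘd s u).ofReal_comp.mul_const I).cexp)
  have hB : ContDiff ℝ 1 (fun p : ℝ × ℝ => B p.1 p.2) := by
    simp only [hBdef]
    exact contDiff_one_parametric_primitive (f := fun s u => (ρ s u : ℂ))
      (f' := fun s u => (ρ' s u : ℂ)) (Complex.continuous_ofReal.comp hρc)
      (Complex.continuous_ofReal.comp hρ'c) fun s u => (hρd s u).ofReal_comp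
  have hB1 : ∀ s, B s 1 = ((∫ u in (0 : ℝ)..1, ρ s u : ℝ) : ℂ) := fun s => by
    rw [hBdef, intervalIntegral.integral_ofReal]
  have hB0 : ∀ s, B s 1 ≠ 0 := by
    intro s
    rw [hB1]
    exact_mod_cast (intervalIntegral.intervalIntegral_pos_of_pos ((hρs s).intervalIntegrable _ _)
      (hρpos s) zero_lt_one).ne'
  obtain ⟨m, hm⟩ : ∃ m : ℝ → ℂ, ∀ s, m s = A s 1 / B s 1 := ⟨_, fun _ => rfl⟩
  have hmB : ∀ s, m s * B s 1 = A s 1 := fun s => by rw [hm, div_mul_cancel₀ _ (hB0 s)]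
  have hmc : ContDiff ℝ 1 m := by
    have e : ContDiff ℝ 1 (fun s : ℝ => (s, (1 : ℝ))) := by fun_prop
    have hA1 : ContDiff ℝ 1 (fun s => A s 1) := hA.comp e
    have hB1 : ContDiff ℝ 1 (fun s => B s 1) := hB.comp e
    rw [show m = fun s => A s 1 * (B s 1)⁻¹ from funext fun s => by rw [hm, div_eq_mul_inv]]
    exact hA1.mul (hB1.inv hB0)
  have hH : ContDiff ℝ 1 (fun p : ℝ × ℝ => c + (A p.1 p.2 - m p.1 * B p.1 p.2)) :=
    contDiff_const.add (hA.sub ((hmc.comp contDiff_fst).mul hB))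
  have hHd : ∀ s t, HasDerivAt (fun t => c + (A s t - m s * B s t))
      ((ρ s t : ℂ) * (exp (Θ s t * I) - m s)) t := by
    intro s t
    have h1 : HasDerivAt (fun t => A s t) ((ρ s t : ℂ) * exp (Θ s t * I)) t := by
      simp only [hAdef]
      exact ((hΦs s).integral_hasStrictDerivAt 0 t).hasDerivAt
    have h2 : HasDerivAt (fun t => B s t) (ρ s t : ℂ) t := by
      simp only [hBdef]
      exact ((Complex.continuous_ofReal.comp (hρs s)).integral_hasStrictDerivAt 0 t).hasDerivAt
    convert! (h1.sub (h2.const_mul (m s))).const_add c using 1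
    ring
  refine ⟨fun s t => c + (A s t - m s * B s t), hH, fun s => ⟨?_, ?_, ?_⟩, ?_⟩
  · exact hH.comp (by fun_prop : ContDiff ℝ 1 fun t : ℝ => (s, t))
  · intro t
    have hAper : A s (t + 1) = A s t + A s 1 := by
      have := (hΦper s).intervalIntegral_add_eq_add 0 t
        (fun a b => (hΦs s).intervalIntegrable a b)
      simpa only [hAdef, zero_add] using this
    have hBper : B s (t + 1) = B s t + B s 1 := by
      have := Function.Periodic.intervalIntegral_add_eq_add (f := fun u => (ρ s u : ℂ)) (T := 1)
        (fun u => congrArg _ (hρper s u)) 0 t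
        (fun a b => (Complex.continuous_ofReal.comp (hρs s)).intervalIntegrable a b)
      simpa only [hBdef, zero_add] using this
    simp only [hAper, hBper]
    linear_combination -hmB s
  · intro t
    rw [(hHd s t).deriv]
    refine mul_ne_zero (by exact_mod_cast (hρpos s t).ne') (sub_ne_zero.2 fun he => ?_)
    refine exp_mul_integral_ne (hρs s) (hΘs s) (hρpos s) ?_ t ?_
    · have := hΘper s 0
      rw [zero_add] at this
      rw [this, add_sub_cancel_left, abs_mul, abs_of_pos (by positivity : (0 : ℝ) < 2 * π)]
      rcases hn with rfl | rfl <;> simp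
    · rw [he, ← hB1, hmB, hAdef]
  · intro s hs t
    rw [← hAdef] at hs ⊢
    simp [hm, hs]

/-- The primitive of the velocity of the unit circle traversed once in the direction given by
`n = ±1`. -/
theorem integral_circle_velocity {n : ℤ} (hn : n = 1 ∨ n = -1) (t : ℝ) :
    ∫ u in (0 : ℝ)..t, ((2 * π : ℝ) : ℂ) * exp ((2 * π * n * u + n * (π / 2) : ℝ) * I) =
      exp (n * (2 * π * t) * I) - 1 := by
  have h3 : exp (n * (π / 2) * I) = n * I := by
    rcases hn with rfl | rfl
    · simp [Complex.exp_pi_div_two_mul_I]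
    · rw [show ((-1 : ℤ) : ℂ) * (π / 2) * I = -(π / 2 * I) by push_cast; ring,
        Complex.exp_neg, Complex.exp_pi_div_two_mul_I]
      simp
  have h1 : ∀ u : ℝ, HasDerivAt (fun u : ℝ => exp (n * (2 * π * u) * I))
      (((2 * π : ℝ) : ℂ) * exp ((2 * π * n * u + n * (π / 2) : ℝ) * I)) u := fun u => by
    have h2 := ((((Complex.ofRealCLM.hasDerivAt (x := u)).const_mul (2 * π : ℂ)).const_mul
      (n : ℂ)).mul_const I).cexp
    have h4 : exp ((2 * π * n * u + n * (π / 2) : ℝ) * I) =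
        exp (n * (2 * π * u) * I) * (n * I) := by
      rw [← h3, ← Complex.exp_add]
      push_cast
      ring_nf
    convert! h2 using 1
    rw [h4]
    simp only [Complex.ofRealCLM_apply, Complex.ofReal_one]
    push_cast
    ring
  rw [intervalIntegral.integral_eq_sub_of_hasDerivAt (fun u _ => h1 u)
    (Continuous.intervalIntegrable (by fun_prop) 0 t)]
  simp

/-- A regular closed curve of rotation number `n = ±1` is regularly homotopic to the unit circle
traversed once in the direction given by `n`. -/
theorem isRegularHomotopy_circle {γ : ℝ → ℂ} {n : ℤ} (h : IsRegularClosedCurve γ)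
    (hrot : HasRotationNumber γ n) (hn : n = 1 ∨ n = -1) :
    IsRegularHomotopy γ (fun t => (γ 0 - 1) + exp (n * (2 * π * t) * I)) := by
  obtain ⟨hγ, hper, hreg⟩ := h
  obtain ⟨θ, hθ, hangle, hturn⟩ := hrot
  have hdc : Continuous (deriv γ) := hγ.continuous_deriv le_rfl
  have hdper : Function.Periodic (deriv γ) 1 := fun t => by
    rw [← deriv_comp_add_const, show (fun x => γ (x + 1)) = γ from funext hper]
  have hθper : ∀ t, θ (t + 1) = θ t + 2 * π * n := fun t => by
    rw [angle_add_one hdper hreg hθ hangle, hturn]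
  obtain ⟨H, hH, hHreg, hHeq⟩ := exists_contDiff_family_isRegularClosedCurve
    (ρ := fun s u => (1 - s) ^ 2 * ‖deriv γ u‖ + s ^ 2 * (2 * π))
    (ρ' := fun s u => -(2 * (1 - s)) * ‖deriv γ u‖ + 2 * s * (2 * π))
    (Θ := fun s u => (1 - s) * θ u + s * (2 * π * n * u + n * (π / 2)))
    (Θ' := fun _ u => -θ u + (2 * π * n * u + n * (π / 2)))
    hn (by fun_prop) (by fun_prop) (by fun_prop) (by fun_prop)
    (fun s u => by
      have h1 := ((((hasDerivAt_id s).const_sub 1).pow 2).mul_const ‖deriv γ u‖).add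
        (((hasDerivAt_id s).pow 2).mul_const (2 * π))
      convert! h1 using 1
      simp)
    (fun s u => by
      have h1 := (((hasDerivAt_id s).const_sub 1).mul_const (θ u)).add
        ((hasDerivAt_id s).mul_const (2 * π * n * u + n * (π / 2)))
      convert! h1 using 1
      simp)
    (fun s u => by
      have h1 : 0 < ‖deriv γ u‖ := norm_pos_iff.2 (hreg u)
      by_cases hs : s = 0
      · simpa [hs] using hreg u
      · positivity)
    (fun s u => by simp only [hdper u])
    (fun s u => by simp only [hθper u]; ring)
    (γ 0)
  have h0 : ∀ t, ∫ u in (0 : ℝ)..t, deriv γ u = γ t - γ 0 := fun t =>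
    intervalIntegral.integral_deriv_eq_sub
      (fun x _ => hγ.differentiable one_ne_zero x) (hdc.intervalIntegrable _ _)
  have e0 := hHeq 0
  simp only [sub_zero, one_pow, one_mul, ne_eq, OfNat.ofNat_ne_zero, not_false_eq_true, zero_pow,
    zero_mul, add_zero, ← hangle, h0] at e0
  have e1 := hHeq 1
  simp only [sub_self, one_pow, one_mul, ne_eq, OfNat.ofNat_ne_zero, not_false_eq_true, zero_pow,
    zero_mul, zero_add, integral_circle_velocity hn] at e1
  refine ⟨H, hH, fun s _ => hHreg s, ?_, ?_⟩
  · funext t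
    rw [e0 (sub_eq_zero.2 hper.eq)]
    ring
  · funext t
    rw [e1 (sub_eq_zero.2 (Complex.exp_eq_one_iff.2 ⟨n, by push_cast; ring⟩))]
    ring

/-- A regular closed plane curve with rotation number plus or minus one (as produced by
the large-semicircle completion of a curve whose transverse self-intersections come in
rotation-cancelling symmetric pairs) is regularly homotopic to a round circle
(traversed once, with the matching orientation); in particular all of its
self-intersections can be resolved by a regular homotopy. -/
theorem stmt9 (γ : ℝ → ℂ) (h : IsRegularClosedCurve γ)
    (hrot : HasRotationNumber γ 1 ∨ HasRotationNumber γ (-1)) :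
    ∃ (c : ℂ) (r : ℝ), 0 < r ∧
      (IsRegularHomotopy γ (fun t => c + r * Complex.exp (2 * π * t * Complex.I)) ∨
       IsRegularHomotopy γ (fun t => c + r * Complex.exp (-(2 * π * t) * Complex.I))) := by
  refine ⟨γ 0 - 1, 1, one_pos, ?_⟩
  rcases hrot with hrot | hrot
  · left
    simpa using isRegularHomotopy_circle h hrot (Or.inl rfl)
  · right
    simpa using isRegularHomotopy_circle h hrot (Or.inr rfl)
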